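/- Let 0 < ω₀ < π and b ∈ ℝ. The model nonlocal eigenvalue problem has an eigenvalue of multiplicity greater than 1 — i.e., there exist λ₀ ∈ ℂ and a Jordan chain (φ⁽⁰⁾, φ⁽¹⁾) of length 2 at λ₀ — if and only if |b| = 2. -/

import Mathlib

open Set Complex

/-- `φ` is twice continuously differentiable on `[-ω₀, ω₀]`, with first derivative `φ'`
and second derivative `φ''` (derivatives in the sense of `HasDerivWithinAt`). -/
def C2On (ω₀ : ℝ) (φ φ' φ'' : ℝ → ℂ) : Prop :=
  (∀ ω ∈ Icc (-ω₀) ω₀, HasDerivWithinAt φ (φ' ω) (Icc (-ω₀) ω₀) ω) ∧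
  (∀ ω ∈ Icc (-ω₀) ω₀, HasDerivWithinAt φ' (φ'' ω) (Icc (-ω₀) ω₀) ω) ∧
  ContinuousOn φ'' (Icc (-ω₀) ω₀)

/-- The nonlocal conditions `φ(-ω₀) = 0` and `φ(ω₀) + b·φ(0) = 0`. -/
def NonlocalBC (ω₀ b : ℝ) (φ : ℝ → ℂ) : Prop :=
  φ (-ω₀) = 0 ∧ φ ω₀ + (b : ℂ) * φ 0 = 0

/-- `φ` is a (possibly zero) solution of the model nonlocal eigenvalue problem for `λ`:
`φ` is twice continuously differentiable on `[-ω₀, ω₀]`, `φ'' = λ²·φ` there, and the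
nonlocal conditions hold. -/
def IsSolution (ω₀ b : ℝ) (lam : ℂ) (φ : ℝ → ℂ) : Prop :=
  (∃ φ' φ'', C2On ω₀ φ φ' φ'' ∧ ∀ ω ∈ Icc (-ω₀) ω₀, φ'' ω = lam ^ 2 * φ ω) ∧
  NonlocalBC ω₀ b φ

/-- `φ` is an eigenvector: a solution not identically zero on `[-ω₀, ω₀]`. -/
def IsEigenvector (ω₀ b : ℝ) (lam : ℂ) (φ : ℝ → ℂ) : Prop :=
  IsSolution ω₀ b lam φ ∧ ∃ ω ∈ Icc (-ω₀) ω₀, φ ω ≠ 0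

/-- `λ` is an eigenvalue of the model nonlocal eigenvalue problem. -/
def IsEigenvalue (ω₀ b : ℝ) (lam : ℂ) : Prop :=
  ∃ φ : ℝ → ℂ, IsEigenvector ω₀ b lam φ

/-- `ψ` is twice continuously differentiable on `[-ω₀, ω₀]`, solves
`ψ'' - λ²·ψ - f = 0` there, and satisfies the nonlocal conditions. -/
def IsAssociatedSol (ω₀ b : ℝ) (lam : ℂ) (f : ℝ → ℂ) (ψ : ℝ → ℂ) : Prop :=
  (∃ ψ' ψ'', C2On ω₀ ψ ψ' ψ'' ∧
      ∀ ω ∈ Icc (-ω₀) ω₀, ψ'' ω - lam ^ 2 * ψ ω - f ω = 0) ∧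
  NonlocalBC ω₀ b ψ

/-- `(φ0, φ1)` is a Jordan chain of length 2 at `λ`. -/
def IsJordanChain2 (ω₀ b : ℝ) (lam : ℂ) (φ0 φ1 : ℝ → ℂ) : Prop :=
  IsEigenvector ω₀ b lam φ0 ∧
  IsAssociatedSol ω₀ b lam (fun ω => 2 * lam * φ0 ω) φ1

/-- `(φ0, φ1, φ2)` is a Jordan chain of length 3 at `λ`. -/
def IsJordanChain3 (ω₀ b : ℝ) (lam : ℂ) (φ0 φ1 φ2 : ℝ → ℂ) : Prop :=
  IsEigenvector ω₀ b lam φ0 ∧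
  IsAssociatedSol ω₀ b lam (fun ω => 2 * lam * φ0 ω) φ1 ∧
  IsAssociatedSol ω₀ b lam (fun ω => 2 * lam * φ1 ω + φ0 ω) φ2

/-- A function with zero derivative on `[a, c]` is constant there. -/
lemma eq_left_of_hasDerivWithinAt_zero {a c : ℝ} (hac : a < c) {g : ℝ → ℂ}
    (hg : ∀ x ∈ Icc a c, HasDerivWithinAt g 0 (Icc a c) x) {x : ℝ} (hx : x ∈ Icc a c) :
    g x = g a :=
  constant_of_derivWithin_zero (fun y hy => (hg y hy).differentiableWithinAt)
    (fun y hy => (hg y (Ico_subset_Icc_self hy)).derivWithin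
      (uniqueDiffOn_Icc hac y (Ico_subset_Icc_self hy))) x hx

lemma hasDerivAt_shift (a x : ℝ) : HasDerivAt (fun y : ℝ => (y : ℂ) - a) 1 x :=
  (hasDerivAt_id x).ofReal_comp.sub_const _

lemma hasDerivAt_exp_shift (μ : ℂ) (a x : ℝ) :
    HasDerivAt (fun y : ℝ => exp (μ * ((y : ℂ) - a))) (exp (μ * ((x : ℂ) - a)) * μ) x := by
  simpa using ((hasDerivAt_shift a x).const_mul μ).cexp

lemma hasDerivAt_sinh_shift (μ : ℂ) (a x : ℝ) :
    HasDerivAt (fun y : ℝ => sinh (μ * ((y : ℂ) - a))) (cosh (μ * ((x : ℂ) - a)) * μ) x :=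
  ((Complex.hasDerivAt_sinh _).comp x ((hasDerivAt_shift a x).const_mul μ)).congr_deriv
    (by rw [mul_one])

lemma hasDerivAt_cosh_shift (μ : ℂ) (a x : ℝ) :
    HasDerivAt (fun y : ℝ => cosh (μ * ((y : ℂ) - a))) (sinh (μ * ((x : ℂ) - a)) * μ) x :=
  ((Complex.hasDerivAt_cosh _).comp x ((hasDerivAt_shift a x).const_mul μ)).congr_deriv
    (by rw [mul_one])

/-- Solutions of `g' = μ g` are exponentials. -/
lemma eq_exp_of_hasDerivWithinAt {a c : ℝ} (hac : a < c) {g : ℝ → ℂ} {μ : ℂ}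
    (hg : ∀ x ∈ Icc a c, HasDerivWithinAt g (μ * g x) (Icc a c) x) {x : ℝ}
    (hx : x ∈ Icc a c) : g x = g a * exp (μ * ((x : ℂ) - a)) := by
  have h := eq_left_of_hasDerivWithinAt_zero hac
    (g := fun y => g y * exp (-μ * ((y : ℂ) - a)))
    (fun y hy => ((hg y hy).mul (hasDerivAt_exp_shift (-μ) a y).hasDerivWithinAt).congr_deriv
      (by ring)) hx
  simp only [sub_self, mul_zero, exp_zero, mul_one] at h
  rw [← h, mul_assoc, ← exp_add]
  simp

/-- Solutions of `φ'' = μ² φ` vanishing at the left endpoint are multiples of `sinh`. -/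
lemma mul_eq_sinh_of_hasDerivWithinAt {a c : ℝ} (hac : a < c) {φ φ' φ'' : ℝ → ℂ} {μ : ℂ}
    (h1 : ∀ x ∈ Icc a c, HasDerivWithinAt φ (φ' x) (Icc a c) x)
    (h2 : ∀ x ∈ Icc a c, HasDerivWithinAt φ' (φ'' x) (Icc a c) x)
    (h : ∀ x ∈ Icc a c, φ'' x = μ ^ 2 * φ x) (h0 : φ a = 0) {x : ℝ} (hx : x ∈ Icc a c) :
    μ * φ x = φ' a * sinh (μ * ((x : ℂ) - a)) := by
  have key : ∀ ν : ℂ, ν ^ 2 = μ ^ 2 → φ' x + ν * φ x = φ' a * exp (ν * ((x : ℂ) - a)) := by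
    intro ν hν
    have := eq_exp_of_hasDerivWithinAt hac (g := fun y => φ' y + ν * φ y) (μ := ν)
      (fun y hy => ((h2 y hy).add ((h1 y hy).const_mul ν)).congr_deriv
        (by rw [h y hy, ← hν]; ring)) hx
    simpa [h0] using this
  have hp := key μ rfl
  have hm := key (-μ) (by ring)
  rw [neg_mul μ ((x : ℂ) - a)] at hm
  rw [Complex.sinh]
  linear_combination (hp - hm) / 2

/-- Solutions of `φ'' = 0` vanishing at the left endpoint are linear. -/
lemma eq_linear_of_hasDerivWithinAt {a c : ℝ} (hac : a < c) {φ φ' φ'' : ℝ → ℂ}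
    (h1 : ∀ x ∈ Icc a c, HasDerivWithinAt φ (φ' x) (Icc a c) x)
    (h2 : ∀ x ∈ Icc a c, HasDerivWithinAt φ' (φ'' x) (Icc a c) x)
    (h : ∀ x ∈ Icc a c, φ'' x = 0) (h0 : φ a = 0) {x : ℝ} (hx : x ∈ Icc a c) :
    φ x = φ' a * ((x : ℂ) - a) := by
  have hc : ∀ y ∈ Icc a c, φ' y = φ' a := fun y hy =>
    eq_left_of_hasDerivWithinAt_zero hac (fun z hz => (h2 z hz).congr_deriv (h z hz)) hy
  have := eq_left_of_hasDerivWithinAt_zero hac (g := fun y => φ y - φ' a * ((y : ℂ) - a))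
    (fun y hy => ((h1 y hy).sub
      ((hasDerivAt_shift a y).hasDerivWithinAt.const_mul (φ' a))).congr_deriv
        (by rw [hc y hy]; ring)) hx
  simpa [h0, sub_eq_zero] using this

/-- The characteristic function `sinh (2 * z) + b * sinh z` and its derivative vanish simultaneously
only if `|b| = 2`. -/
lemma abs_eq_two_of_double_zero {b : ℝ} {z : ℂ} (h1 : sinh (2 * z) + b * sinh z = 0)
    (h2 : 2 * cosh (2 * z) + b * cosh z = 0) : |b| = 2 := by
  have hcs := Complex.cosh_sq z
  rw [Complex.sinh_two_mul] at h1
  rw [Complex.cosh_two_mul] at h2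
  have hs : sinh z = 0 := by
    have h : sinh z * (2 * cosh z + b) = 0 := by linear_combination h1
    rcases mul_eq_zero.mp h with h | h
    · exact h
    · have : sinh z ^ 2 = 0 := by linear_combination (h2 - cosh z * h) / 2
      exact pow_eq_zero_iff two_ne_zero |>.mp this
  rw [hs] at h2 hcs
  have hc : cosh z ^ 2 = 1 := by linear_combination hcs
  have hb : (b : ℂ) ^ 2 = 4 := by
    linear_combination (b * cosh z - 2) * h2 + (-b ^ 2 - 2 * b * cosh z + 4) * hc
  have hb' : b ^ 2 = 2 ^ 2 := by
    have : b ^ 2 = 4 := by exact_mod_cast hb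
    linarith
  simpa using sq_eq_sq_iff_abs_eq_abs _ _ |>.mp hb'

lemma abs_eq_two_of_isJordanChain2 {ω₀ b : ℝ} (hω₀ : 0 < ω₀) {lam : ℂ} {φ ψ : ℝ → ℂ}
    (hchain : IsJordanChain2 ω₀ b lam φ ψ) : |b| = 2 := by
  obtain ⟨⟨⟨⟨φ', φ'', ⟨h1, h2, -⟩, hφ⟩, hl, hr⟩, x, hx, hne⟩,
    ⟨ψ', ψ'', ⟨k1, k2, -⟩, hψ⟩, kl, kr⟩ := hchain
  have hlt : -ω₀ < ω₀ := by linarith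
  have hωC : (ω₀ : ℂ) ≠ 0 := by exact_mod_cast hω₀.ne'
  have m0 : (0 : ℝ) ∈ Icc (-ω₀) ω₀ := ⟨by linarith, hω₀.le⟩
  have mr : ω₀ ∈ Icc (-ω₀) ω₀ := ⟨hlt.le, le_rfl⟩
  by_cases hlam : lam = 0
  · subst hlam
    have sol : ∀ {y}, y ∈ Icc (-ω₀) ω₀ → φ y = φ' (-ω₀) * ((y : ℂ) - (-ω₀ : ℝ)) := fun hy =>
      eq_linear_of_hasDerivWithinAt hlt h1 h2 (fun z hz => by simp [hφ z hz]) hl hy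
    have hc : φ' (-ω₀) ≠ 0 := fun hc => hne (by simp [sol hx, hc])
    rw [sol mr, sol m0] at hr
    push_cast at hr
    have : (b : ℂ) = -2 := by
      apply mul_left_cancel₀ (mul_ne_zero hc hωC)
      linear_combination hr
    have : b = -2 := by exact_mod_cast this
    simp [this]
  · have sol : ∀ {y}, y ∈ Icc (-ω₀) ω₀ →
        lam * φ y = φ' (-ω₀) * sinh (lam * ((y : ℂ) - (-ω₀ : ℝ))) := fun hy =>
      mul_eq_sinh_of_hasDerivWithinAt hlt h1 h2 hφ hl hy
    have hc : φ' (-ω₀) ≠ 0 := fun hc => by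
      have := sol hx
      simp [hc, hlam, hne] at this
    set c := φ' (-ω₀) with hcdef
    have e2 : lam * ((ω₀ : ℂ) - (-ω₀ : ℝ)) = 2 * (lam * ω₀) := by push_cast; ring
    have e1 : lam * (((0 : ℝ) : ℂ) - (-ω₀ : ℝ)) = lam * ω₀ := by push_cast; ring
    have hS : sinh (2 * (lam * ω₀)) + b * sinh (lam * ω₀) = 0 := by
      have a1 := sol mr
      have a2 := sol m0
      rw [e2] at a1
      rw [e1] at a2
      apply mul_left_cancel₀ hc
      linear_combination lam * hr - a1 - b * a2
    have hp1 := fun y : ℝ => ((hasDerivAt_shift (-ω₀) y).mul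
      (hasDerivAt_cosh_shift lam (-ω₀) y)).const_mul c
    have hp2 := fun y : ℝ => ((hasDerivAt_cosh_shift lam (-ω₀) y).add
      ((hasDerivAt_shift (-ω₀) y).mul
        ((hasDerivAt_sinh_shift lam (-ω₀) y).mul_const lam))).const_mul c
    have sol' := fun {y : ℝ} (hy : y ∈ Icc (-ω₀) ω₀) =>
      mul_eq_sinh_of_hasDerivWithinAt hlt (μ := lam)
        (φ := fun y => lam * ψ y - c * (((y : ℂ) - (-ω₀ : ℝ)) *
          cosh (lam * ((y : ℂ) - (-ω₀ : ℝ)))))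
        (φ' := fun y => lam * ψ' y - c * (cosh (lam * ((y : ℂ) - (-ω₀ : ℝ))) +
          ((y : ℂ) - (-ω₀ : ℝ)) * (sinh (lam * ((y : ℂ) - (-ω₀ : ℝ))) * lam)))
        (fun z hz => (((k1 z hz).const_mul lam).sub (hp1 z).hasDerivWithinAt).congr_deriv
          (by ring))
        (fun z hz => ((k2 z hz).const_mul lam).sub (hp2 z).hasDerivWithinAt)
        (fun z hz => by linear_combination lam * hψ z hz + 2 * lam * sol hz)
        (by simp [kl]) hy
    have a1 := sol' mr
    have a2 := sol' m0
    rw [e2] at a1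
    rw [e1] at a2
    refine abs_eq_two_of_double_zero (z := lam * ω₀) hS ?_
    apply mul_left_cancel₀ (mul_ne_zero hlam (mul_ne_zero hc hωC))
    generalize lam * ψ' (-ω₀) - _ = d at a1 a2
    push_cast at a1 a2
    linear_combination lam ^ 2 * kr - a1 - b * a2 - d * hS

lemma exists_isJordanChain2_neg_two (ω₀ : ℝ) (hω₀ : 0 < ω₀) :
    ∃ (lam : ℂ) (φ ψ : ℝ → ℂ), IsJordanChain2 ω₀ (-2) lam φ ψ := by
  refine ⟨0, fun y => (y : ℂ) - (-ω₀ : ℝ), fun _ => 0, ⟨⟨⟨fun _ => 1, fun _ => 0,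
    ⟨fun y _ => (hasDerivAt_shift _ y).hasDerivWithinAt, fun y _ => hasDerivWithinAt_const _ _ _,
      continuousOn_const⟩, by simp⟩, by simp, by push_cast; ring⟩,
    0, ⟨by linarith, hω₀.le⟩, by simpa using hω₀.ne'⟩, ⟨fun _ => 0, fun _ => 0,
    ⟨fun y _ => hasDerivWithinAt_const _ _ _, fun y _ => hasDerivWithinAt_const _ _ _,
      continuousOn_const⟩, by simp⟩, by simp, by simp⟩

lemma exists_isJordanChain2_two (ω₀ : ℝ) (hω₀ : 0 < ω₀) :
    ∃ (lam : ℂ) (φ ψ : ℝ → ℂ), IsJordanChain2 ω₀ 2 lam φ ψ := by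
  have hωC : (ω₀ : ℂ) ≠ 0 := by exact_mod_cast hω₀.ne'
  obtain ⟨lam, hlam⟩ : ∃ lam : ℂ, lam * ω₀ = Real.pi * I :=
    ⟨Real.pi * I / ω₀, div_mul_cancel₀ _ hωC⟩
  have e2 : lam * ((ω₀ : ℂ) - (-ω₀ : ℝ)) = (2 * Real.pi : ℂ) * I := by
    push_cast; linear_combination 2 * hlam
  have e1 : lam * (((0 : ℝ) : ℂ) - (-ω₀ : ℝ)) = Real.pi * I := by
    push_cast; linear_combination hlam
  have eh : lam * (((-(ω₀ / 2) : ℝ) : ℂ) - (-ω₀ : ℝ)) = (Real.pi / 2 : ℂ) * I := by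
    push_cast; linear_combination hlam / 2
  have hs := hasDerivAt_sinh_shift lam (-ω₀)
  have hc := hasDerivAt_cosh_shift lam (-ω₀)
  have ht := hasDerivAt_shift (-ω₀)
  refine ⟨lam, fun y => sinh (lam * ((y : ℂ) - (-ω₀ : ℝ))),
    fun y => ((y : ℂ) - (-ω₀ : ℝ)) * cosh (lam * ((y : ℂ) - (-ω₀ : ℝ))),
    ⟨⟨⟨_, _, ⟨fun y _ => (hs y).hasDerivWithinAt,
      fun y _ => ((hc y).mul_const lam).hasDerivWithinAt, by fun_prop⟩,
      fun y _ => by ring⟩, by simp, ?_⟩, -(ω₀ / 2), ⟨by linarith, by linarith⟩, ?_⟩,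
    ⟨_, _, ⟨fun y _ => ((ht y).mul (hc y)).hasDerivWithinAt,
      fun y _ => (((hc y).const_mul 1).add
        ((ht y).mul ((hs y).mul_const lam))).hasDerivWithinAt, by fun_prop⟩,
      fun y _ => by ring⟩, by simp, ?_⟩
  · simp only [e1, e2, sinh_mul_I, sin_two_pi, sin_pi]
    simp
  · simp only [eh, sinh_mul_I, sin_pi_div_two]
    simp
  · simp only [e1, e2, cosh_mul_I, cos_two_pi, cos_pi]
    push_cast; ring

/-- The model nonlocal eigenvalue problem has an eigenvalue of multiplicity greater
than 1 (i.e. there is a Jordan chain of length 2 at some `λ₀ ∈ ℂ`) if and only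
if `|b| = 2`. -/
theorem statement13 (ω₀ b : ℝ) (hω₀ : 0 < ω₀) (hω₀' : ω₀ < Real.pi) :
    (∃ (lam₀ : ℂ) (φ0 φ1 : ℝ → ℂ), IsJordanChain2 ω₀ b lam₀ φ0 φ1) ↔ |b| = 2 := by
  constructor
  · rintro ⟨lam, φ, ψ, h⟩
    exact abs_eq_two_of_isJordanChain2 hω₀ h
  · intro h
    rcases eq_or_eq_neg_of_abs_eq h with rfl | rfl
    · exact exists_isJordanChain2_two ω₀ hω₀
    · exact exists_isJordanChain2_neg_two ω₀ hω₀
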